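/- Let K ⊆ ℝ^d and Z ⊆ ℝ^d be finite sets, let ε ≥ 0, let z ∈ Z with ¬_ε z nonempty, let w : K → [0,∞), let μ, μ̂, λ ∈ ℝ^d, and let c : K → [0,∞) satisfy ⟨μ̂−μ, a⟩² ≤ c(a) for every a ∈ K. Define U(a) = (|⟨μ̂−λ, a⟩| + √(c(a)))² for a ∈ K. If λ ∈ ¬_ε z or μ̂ ∈ ¬_ε z, then ∑_{a∈K} w(a)·U(a) ≥ inf over λ' ∈ ¬_ε z of ∑_{a∈K} w(a)·⟨μ−λ', a⟩². -/

import Mathlib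

open Matrix

noncomputable section

/-- The additive `ε`-optimal answers `Z_ε(μ)`. -/
def epsOpt {d : ℕ} (Z : Finset (Fin d → ℝ)) (ε : ℝ) (μ : Fin d → ℝ) :
    Set (Fin d → ℝ) :=
  {z | z ∈ Z ∧ ∀ x ∈ Z, μ ⬝ᵥ x - ε ≤ μ ⬝ᵥ z}

/-- The alternative `¬_ε z`. -/
def altSet {d : ℕ} (Z : Finset (Fin d → ℝ)) (ε : ℝ) (z : Fin d → ℝ) :
    Set (Fin d → ℝ) :=
  closure {lam | z ∉ epsOpt Z ε lam}

/-- The optimistic gains `U(a) = (|⟨μ̂-λ, a⟩| + √(c a))²` dominate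
the value `inf_{λ'∈¬_ε z} ∑_a w(a)·⟨μ-λ', a⟩²` whenever `λ ∈ ¬_ε z` or `μ̂ ∈ ¬_ε z`,
provided the slacks `c` bound the squared estimation errors `⟨μ̂-μ, a⟩²`. -/
theorem stmt14 {d : ℕ} (K Z : Finset (Fin d → ℝ)) (ε : ℝ) (hε : 0 ≤ ε)
    (z : Fin d → ℝ) (hz : z ∈ Z) (halt : (altSet Z ε z).Nonempty)
    (w : (Fin d → ℝ) → ℝ) (hw : ∀ a ∈ K, 0 ≤ w a)
    (μ μhat lam : Fin d → ℝ) (c : (Fin d → ℝ) → ℝ) (hc0 : ∀ a ∈ K, 0 ≤ c a)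
    (hc : ∀ a ∈ K, ((μhat - μ) ⬝ᵥ a) ^ 2 ≤ c a)
    (hcase : lam ∈ altSet Z ε z ∨ μhat ∈ altSet Z ε z) :
    sInf ((fun lam' => ∑ a ∈ K, w a * ((μ - lam') ⬝ᵥ a) ^ 2) '' altSet Z ε z)
      ≤ ∑ a ∈ K, w a * (|(μhat - lam) ⬝ᵥ a| + Real.sqrt (c a)) ^ 2 := by
  have key : ∀ l ∈ altSet Z ε z,
      (∀ a ∈ K, |(μ - l) ⬝ᵥ a| ≤ |(μhat - lam) ⬝ᵥ a| + Real.sqrt (c a)) →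
      sInf ((fun lam' => ∑ a ∈ K, w a * ((μ - lam') ⬝ᵥ a) ^ 2) '' altSet Z ε z)
        ≤ ∑ a ∈ K, w a * (|(μhat - lam) ⬝ᵥ a| + Real.sqrt (c a)) ^ 2 := by
    intro l hl h
    refine (csInf_le ⟨0, ?_⟩ (Set.mem_image_of_mem _ hl)).trans ?_
    · rintro _ ⟨l', _, rfl⟩
      exact Finset.sum_nonneg fun a ha => mul_nonneg (hw a ha) (sq_nonneg _)
    · refine Finset.sum_le_sum fun a ha => mul_le_mul_of_nonneg_left ?_ (hw a ha)
      rw [← sq_abs ((μ - l) ⬝ᵥ a)]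
      exact pow_le_pow_left₀ (abs_nonneg _) (h a ha) 2
  have hs : ∀ a ∈ K, |(μhat - μ) ⬝ᵥ a| ≤ Real.sqrt (c a) := fun a ha =>
    Real.abs_le_sqrt (hc a ha)
  rcases hcase with h | h
  · refine key lam h fun a ha => ?_
    have e : (μ - lam) ⬝ᵥ a = (μhat - lam) ⬝ᵥ a - (μhat - μ) ⬝ᵥ a := by
      simp only [sub_dotProduct]; ring
    rw [e]
    exact (abs_sub _ _).trans (by linarith [hs a ha])
  · refine key μhat h fun a ha => ?_
    have e : (μ - μhat) ⬝ᵥ a = - ((μhat - μ) ⬝ᵥ a) := by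
      simp only [sub_dotProduct]; ring
    rw [e, abs_neg]
    linarith [hs a ha, abs_nonneg ((μhat - lam) ⬝ᵥ a)]

end
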